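/- arXiv:2003.00360 — 3 statements merged into one kernel-verified Lean document; each statement's English description precedes it below -/
import Mathlib

section
/- Let S be a nonempty compact subset of ℝ^d, let c_1, …, c_N ∈ ℝ^d with N ≥ 1, and let c̄ = (1/N) ∑_{i=1}^N c_i be their average. If the set W*(c̄) of minimizers of w ↦ ⟪c̄, w⟫ over S is a singleton, then for every ĉ ∈ ℝ^d, ∑_{i=1}^N ℓ_SPO(c̄, c_i) ≤ ∑_{i=1}^N ℓ_SPO(ĉ, c_i). That is, the average cost vector minimizes the total SPO loss over the sample. -/
open scoped RealInnerProductSpace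

/-- `zStar S c = min_{w ∈ S} ⟪c, w⟫`, the optimal value of the decision problem. -/
noncomputable def zStar {d : ℕ} (S : Set (EuclideanSpace ℝ (Fin d)))
    (c : EuclideanSpace ℝ (Fin d)) : ℝ :=
  sInf ((fun w => ⟪c, w⟫) '' S)

/-- `WStar S c` is the set of optimal decisions for cost vector `c`. -/
def WStar {d : ℕ} (S : Set (EuclideanSpace ℝ (Fin d)))
    (c : EuclideanSpace ℝ (Fin d)) : Set (EuclideanSpace ℝ (Fin d)) :=
  {w ∈ S | ⟪c, w⟫ = zStar S c}

/-- The SPO loss `ℓ_SPO(ĉ, c) = max_{w ∈ W*(ĉ)} ⟪c, w⟫ − z*(c)`. -/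
noncomputable def spoLoss {d : ℕ} (S : Set (EuclideanSpace ℝ (Fin d)))
    (chat c : EuclideanSpace ℝ (Fin d)) : ℝ :=
  sSup ((fun w => ⟪c, w⟫) '' WStar S chat) - zStar S c

theorem bddBelow_inner_image {d : ℕ} {S : Set (EuclideanSpace ℝ (Fin d))}
    (hS : IsCompact S) (c : EuclideanSpace ℝ (Fin d)) :
    BddBelow ((fun w => ⟪c, w⟫) '' S) :=
  hS.bddBelow_image (by fun_prop)

theorem bddAbove_inner_image_WStar {d : ℕ} {S : Set (EuclideanSpace ℝ (Fin d))}
    (hS : IsCompact S) (chat c : EuclideanSpace ℝ (Fin d)) :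
    BddAbove ((fun w => ⟪c, w⟫) '' WStar S chat) :=
  (hS.bddAbove_image (by fun_prop)).mono (Set.image_mono (Set.sep_subset _ _))

theorem WStar_nonempty {d : ℕ} {S : Set (EuclideanSpace ℝ (Fin d))}
    (hS : IsCompact S) (hSne : S.Nonempty) (c : EuclideanSpace ℝ (Fin d)) :
    (WStar S c).Nonempty := by
  obtain ⟨w, hw, h⟩ := hS.exists_sInf_image_eq hSne
    (f := fun w => ⟪c, w⟫) (by fun_prop)
  exact ⟨w, hw, h.symm⟩

/-- The average cost vector minimizes the total SPO loss over the sample. -/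
theorem average_minimizes_spo_loss {d N : ℕ} (S : Set (EuclideanSpace ℝ (Fin d)))
    (hS : IsCompact S) (hSne : S.Nonempty) (hN : 1 ≤ N)
    (c : Fin N → EuclideanSpace ℝ (Fin d))
    (cbar : EuclideanSpace ℝ (Fin d)) (hcbar : cbar = (N : ℝ)⁻¹ • ∑ i, c i)
    (hsing : ∃ w, WStar S cbar = {w})
    (chat : EuclideanSpace ℝ (Fin d)) :
    ∑ i, spoLoss S cbar (c i) ≤ ∑ i, spoLoss S chat (c i) := by
  obtain ⟨w, hw⟩ := hsing
  obtain ⟨v, hv⟩ := WStar_nonempty hS hSne chat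
  have hwmem : w ∈ WStar S cbar := hw ▸ Set.mem_singleton w
  have hNpos : (0 : ℝ) < (N : ℝ)⁻¹ := by
    have : 0 < N := hN
    positivity
  have hwv : ⟪cbar, w⟫ ≤ ⟪cbar, v⟫ :=
    hwmem.2.trans_le (csInf_le (bddBelow_inner_image hS cbar) (Set.mem_image_of_mem _ hv.1))
  rw [hcbar, real_inner_smul_left, real_inner_smul_left, sum_inner, sum_inner] at hwv
  have hsum : ∑ i, ⟪c i, w⟫ ≤ ∑ i, ⟪c i, v⟫ := le_of_mul_le_mul_left hwv hNpos
  simp only [spoLoss, hw, Set.image_singleton, csSup_singleton, Finset.sum_sub_distrib]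
  refine sub_le_sub_right (hsum.trans (Finset.sum_le_sum fun i _ => ?_)) _
  exact le_csSup (bddAbove_inner_image_WStar hS chat (c i)) (Set.mem_image_of_mem _ hv)
end

section
/- Let S be a nonempty compact subset of ℝ^d, let c_1, …, c_N ∈ ℝ^d with N ≥ 1, and let c̄ = (1/N) ∑_{i=1}^N c_i be their average. If W*(c̄) = {w̄} is a singleton, then the minimum total SPO loss over all predictions equals the excess total cost of the decision w̄: inf_{ĉ ∈ ℝ^d} ∑_{i=1}^N ℓ_SPO(ĉ, c_i) = ∑_{i=1}^N ( ⟪c_i, w̄⟫ − z*(c_i) ), and this infimum is attained at ĉ = c̄. -/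
open scoped RealInnerProductSpace

theorem zStar_le_inner {d : ℕ} {S : Set (EuclideanSpace ℝ (Fin d))} (hS : IsCompact S)
    (c : EuclideanSpace ℝ (Fin d)) {w : EuclideanSpace ℝ (Fin d)} (hw : w ∈ S) :
    zStar S c ≤ ⟪c, w⟫ :=
  csInf_le (bddBelow_inner_image hS c) ⟨w, hw, rfl⟩

theorem inner_sub_zStar_le_spoLoss {d : ℕ} {S : Set (EuclideanSpace ℝ (Fin d))}
    (hS : IsCompact S) {chat w : EuclideanSpace ℝ (Fin d)} (hw : w ∈ WStar S chat)
    (c : EuclideanSpace ℝ (Fin d)) : ⟪c, w⟫ - zStar S c ≤ spoLoss S chat c := by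
  have hbdd : BddAbove ((fun w => ⟪c, w⟫) '' S) := (hS.image (by fun_prop)).bddAbove
  exact sub_le_sub_right (le_csSup (hbdd.mono (Set.image_mono fun _ h => h.1)) ⟨w, hw, rfl⟩) _

/-- The minimum total SPO loss over all predictions equals the excess total cost of the
decision `w̄`, and this infimum is attained at `ĉ = c̄`. -/
theorem min_total_spo_loss_eq_excess_cost {d N : ℕ} (S : Set (EuclideanSpace ℝ (Fin d)))
    (hS : IsCompact S) (hSne : S.Nonempty) (hN : 1 ≤ N)
    (c : Fin N → EuclideanSpace ℝ (Fin d))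
    (cbar : EuclideanSpace ℝ (Fin d)) (hcbar : cbar = (N : ℝ)⁻¹ • ∑ i, c i)
    (wbar : EuclideanSpace ℝ (Fin d)) (hsing : WStar S cbar = {wbar}) :
    sInf (Set.range fun chat => ∑ i, spoLoss S chat (c i))
        = ∑ i, (⟪c i, wbar⟫ - zStar S (c i)) ∧
      ∑ i, spoLoss S cbar (c i) = ∑ i, (⟪c i, wbar⟫ - zStar S (c i)) := by
  have hbar : wbar ∈ WStar S cbar := hsing ▸ Set.mem_singleton wbar
  have hattained : ∑ i, spoLoss S cbar (c i) = ∑ i, (⟪c i, wbar⟫ - zStar S (c i)) := by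
    simp [spoLoss, hsing]
  have hN0 : (N : ℝ) ≠ 0 := by positivity
  have hsum : ∀ w, ∑ i, ⟪c i, w⟫ = N * ⟪cbar, w⟫ := fun w => by
    rw [hcbar, real_inner_smul_left, sum_inner, mul_inv_cancel_left₀ hN0]
  have hlower : ∀ chat, ∑ i, (⟪c i, wbar⟫ - zStar S (c i)) ≤ ∑ i, spoLoss S chat (c i) := by
    intro chat
    obtain ⟨w, hw⟩ := WStar_nonempty hS hSne chat
    calc ∑ i, (⟪c i, wbar⟫ - zStar S (c i)) ≤ ∑ i, (⟪c i, w⟫ - zStar S (c i)) := by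
          rw [Finset.sum_sub_distrib, Finset.sum_sub_distrib, hsum, hsum, hbar.2]
          gcongr
          exact zStar_le_inner hS cbar hw.1
      _ ≤ ∑ i, spoLoss S chat (c i) :=
          Finset.sum_le_sum fun i _ => inner_sub_zStar_le_spoLoss hS hw (c i)
  have hleast : IsLeast (Set.range fun chat => ∑ i, spoLoss S chat (c i))
      (∑ i, (⟪c i, wbar⟫ - zStar S (c i))) :=
    ⟨⟨cbar, hattained⟩, Set.forall_mem_range.2 hlower⟩
  exact ⟨hleast.csInf_eq, hattained⟩
end

section
/- Let S be a nonempty compact subset of ℝ^d, let c_1, …, c_n ∈ ℝ^d, and let R_1, …, R_L be a partition of {1, …, n} into nonempty leaves with leaf averages c̄_l = (1/|R_l|) ∑_{i ∈ R_l} c_i. Suppose each W*(c̄_l) = {w̄_l} is a singleton. Then ∑_{l=1}^L ∑_{i ∈ R_l} ( ⟪c_i, w̄_l⟫ − z*(c_i) ) = min over (w_1, …, w_L) ∈ S^L of ∑_{l=1}^L ∑_{i ∈ R_l} ( ⟪c_i, w_l⟫ − z*(c_i) ); that is, the leafwise mean-cost decisions jointly minimize the total excess cost over all choices of one decision per leaf.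 -/
open scoped RealInnerProductSpace

/-- An optimal decision for the average of finitely many cost vectors minimizes their total
cost. -/
theorem sum_inner_le_of_mem_WStar_average {d : ℕ} {ι : Type*}
    {S : Set (EuclideanSpace ℝ (Fin d))} (hS : IsCompact S)
    (c : ι → EuclideanSpace ℝ (Fin d)) (s : Finset ι)
    {v w : EuclideanSpace ℝ (Fin d)}
    (hv : v ∈ WStar S ((s.card : ℝ)⁻¹ • ∑ i ∈ s, c i)) (hw : w ∈ S) :
    ∑ i ∈ s, ⟪c i, v⟫ ≤ ∑ i ∈ s, ⟪c i, w⟫ := by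
  obtain rfl | hs := s.eq_empty_or_nonempty
  · simp
  have h := hv.2.trans_le (zStar_le_inner hS _ hw)
  rw [real_inner_smul_left, real_inner_smul_left, sum_inner, sum_inner] at h
  have hpos : (0 : ℝ) < (s.card : ℝ)⁻¹ := inv_pos.2 (by exact_mod_cast hs.card_pos)
  exact le_of_mul_le_mul_left h hpos

/-- The leafwise mean-cost decisions jointly minimize the total excess cost over all
choices of one decision per leaf. -/
theorem leafwise_decisions_jointly_optimal {d n L : ℕ} (S : Set (EuclideanSpace ℝ (Fin d)))
    (hS : IsCompact S) (hSne : S.Nonempty)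
    (c : Fin n → EuclideanSpace ℝ (Fin d))
    (R : Fin L → Finset (Fin n))
    (hRne : ∀ l, (R l).Nonempty)
    (hRdisj : ∀ l l', l ≠ l' → Disjoint (R l) (R l'))
    (hRcover : ∀ i, ∃ l, i ∈ R l)
    (cbar : Fin L → EuclideanSpace ℝ (Fin d))
    (hcbar : ∀ l, cbar l = ((R l).card : ℝ)⁻¹ • ∑ i ∈ R l, c i)
    (wbar : Fin L → EuclideanSpace ℝ (Fin d))
    (hsing : ∀ l, WStar S (cbar l) = {wbar l}) :
    ∑ l, ∑ i ∈ R l, (⟪c i, wbar l⟫ - zStar S (c i))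
      = sInf ((fun w : Fin L → EuclideanSpace ℝ (Fin d) =>
          ∑ l, ∑ i ∈ R l, (⟪c i, w l⟫ - zStar S (c i))) '' {w | ∀ l, w l ∈ S}) := by
  have hmem : ∀ l, wbar l ∈ WStar S (cbar l) := fun l => by simp [hsing l]
  refine Eq.symm (IsLeast.csInf_eq ⟨⟨wbar, fun l => (hmem l).1, rfl⟩, ?_⟩)
  rintro _ ⟨w, hw, rfl⟩
  refine Finset.sum_le_sum fun l _ => ?_
  rw [Finset.sum_sub_distrib, Finset.sum_sub_distrib]
  exact sub_le_sub_right
    (sum_inner_le_of_mem_WStar_average hS c (R l) (hcbar l ▸ hmem l) (hw l)) _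
end
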